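/- Let A be a skeletally small additive category. Then the canonical map from the split Grothendieck group K₀^sp(A) to the Grothendieck group K₀(K^b(A)) of the bounded homotopy category of complexes over A, sending the class of an object X to the class of the complex X concentrated in degree 0, is an isomorphism of abelian groups. -/

import Mathlib

open CategoryTheory CategoryTheory.Limits CategoryTheory.Pretriangulated

universe v u

variable (A : Type u) [Category.{v} A] [Preadditive A] [HasZeroObject A]
  [HasBinaryBiproducts A]

/-- The relations of the split Grothendieck group `K₀^sp(A)`: identifications along
isomorphisms and `[X ⊕ Z] = [X] + [Z]`. -/
def splitRels : Set (FreeAbelianGroup A) :=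
  {z | ∃ X Y : A, Nonempty (X ≅ Y) ∧
        z = FreeAbelianGroup.of X - FreeAbelianGroup.of Y} ∪
  {z | ∃ X Z : A, z = FreeAbelianGroup.of (X ⊞ Z)
        - FreeAbelianGroup.of X - FreeAbelianGroup.of Z}

/-- The split Grothendieck group of the additive category `A`. -/
def K0sp : Type u := FreeAbelianGroup A ⧸ AddSubgroup.closure (splitRels A)

noncomputable instance : AddCommGroup (K0sp A) :=
  inferInstanceAs (AddCommGroup (FreeAbelianGroup A ⧸ AddSubgroup.closure (splitRels A)))

/-- Boundedness of an object of the homotopy category `K(A)`. -/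
def Bdd (X : HomotopyCategory A (ComplexShape.up ℤ)) : Prop :=
  ∃ a b : ℤ, ∀ i : ℤ, (i < a ∨ b < i) → IsZero (X.as.X i)

/-- The relations of `K₀(K^b(A))`: identifications along isomorphisms and
`[X] - [Y] + [Z]` for each distinguished triangle `X → Y → Z → ΣX` of bounded
complexes. -/
def kbRels : Set (FreeAbelianGroup {X : HomotopyCategory A (ComplexShape.up ℤ) // Bdd A X}) :=
  {z | ∃ X Y : {X : HomotopyCategory A (ComplexShape.up ℤ) // Bdd A X},
        Nonempty ((X : HomotopyCategory A (ComplexShape.up ℤ)) ≅ (Y : HomotopyCategory A (ComplexShape.up ℤ))) ∧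
        z = FreeAbelianGroup.of X - FreeAbelianGroup.of Y} ∪
  {z | ∃ T ∈ distTriang (HomotopyCategory A (ComplexShape.up ℤ)),
        ∃ (h₁ : Bdd A T.obj₁) (h₂ : Bdd A T.obj₂) (h₃ : Bdd A T.obj₃),
        z = FreeAbelianGroup.of ⟨T.obj₁, h₁⟩ - FreeAbelianGroup.of ⟨T.obj₂, h₂⟩
              + FreeAbelianGroup.of ⟨T.obj₃, h₃⟩}

/-- The Grothendieck group of the bounded homotopy category `K^b(A)`. -/
def K0Kb : Type (max u v) :=
  FreeAbelianGroup {X : HomotopyCategory A (ComplexShape.up ℤ) // Bdd A X} ⧸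
    AddSubgroup.closure (kbRels A)

noncomputable instance : AddCommGroup (K0Kb A) :=
  inferInstanceAs (AddCommGroup
    (FreeAbelianGroup {X : HomotopyCategory A (ComplexShape.up ℤ) // Bdd A X} ⧸
      AddSubgroup.closure (kbRels A)))

/-- The complex concentrated in degree `0` attached to `X`, as an object of `K(A)`. -/
noncomputable def singleK (X : A) : HomotopyCategory A (ComplexShape.up ℤ) :=
  (HomotopyCategory.quotient A (ComplexShape.up ℤ)).obj
    ((HomologicalComplex.single A (ComplexShape.up ℤ) 0).obj X)


namespace KbAux

open ZeroObject

set_option linter.unusedSectionVars false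

variable {A}

/-- class of an object -/
noncomputable def cl (X : A) : K0sp A :=
  (QuotientAddGroup.mk (FreeAbelianGroup.of X) : FreeAbelianGroup A ⧸ AddSubgroup.closure (splitRels A))

lemma cl_iso {X Y : A} (e : X ≅ Y) : cl X = cl Y := by
  refine (QuotientAddGroup.eq_iff_sub_mem).2 (AddSubgroup.subset_closure ?_)
  exact Or.inl ⟨X, Y, ⟨e⟩, rfl⟩

lemma cl_biprod (X Y : A) : cl (X ⊞ Y) = cl X + cl Y := by
  have : (FreeAbelianGroup.of (X ⊞ Y) : FreeAbelianGroup A) -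
      (FreeAbelianGroup.of X + FreeAbelianGroup.of Y) ∈ AddSubgroup.closure (splitRels A) := by
    refine AddSubgroup.subset_closure (Or.inr ⟨X, Y, ?_⟩)
    abel
  exact (QuotientAddGroup.eq_iff_sub_mem).2 this

lemma cl_zero {X : A} (h : IsZero X) : cl X = 0 := by
  have e : X ⊞ X ≅ X := IsZero.iso ((biprod_isZero_iff X X).2 ⟨h, h⟩) h
  have := cl_biprod X X
  rw [cl_iso e] at this
  simpa using this

lemma exists_sum (F : ℤ → A) (s : Finset ℤ) :
    ∃ (B : A) (ι : ∀ j, F j ⟶ B) (π : ∀ j, B ⟶ F j),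
      (∀ i ∈ s, ι i ≫ π i = 𝟙 _) ∧ (∀ i j, i ≠ j → ι i ≫ π j = 0) ∧
      (∑ j ∈ s, π j ≫ ι j = 𝟙 B) ∧ (∀ i, i ∉ s → ι i = 0) ∧ cl B = ∑ j ∈ s, cl (F j) := by
  classical
  induction s using Finset.induction_on with
  | empty =>
    refine ⟨(0 : A), fun _ => 0, fun _ => 0, by simp, by simp, ?_, by simp, ?_⟩
    · exact (isZero_zero A).eq_of_src _ _
    · simpa using cl_zero (isZero_zero A)
  | insert a s ha ih =>
    obtain ⟨B, ι, π, h1, h2, h3, h4, h5⟩ := ih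
    refine ⟨F a ⊞ B, fun j => if h : j = a then eqToHom (by rw [h]) ≫ biprod.inl else ι j ≫ biprod.inr,
      fun j => if h : j = a then biprod.fst ≫ eqToHom (by rw [h]) else biprod.snd ≫ π j, ?_, ?_, ?_, ?_, ?_⟩
    · intro i hi
      by_cases h : i = a
      · subst h; simp
      · have : i ∈ s := by simpa [h] using hi
        simp [h, h1 i this]
    · intro i j hij
      by_cases h : i = a
      · subst h
        simp [Ne.symm hij]
      · by_cases h' : j = a
        · simp [h, h']
        · simp [h, h', h2 i j hij]
    · rw [Finset.sum_insert ha]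
      trans (biprod.fst ≫ biprod.inl + biprod.snd ≫ (∑ j ∈ s, π j ≫ ι j) ≫ biprod.inr)
      · congr 1
        · simp
        · rw [Preadditive.sum_comp, Preadditive.comp_sum]
          refine Finset.sum_congr rfl fun j hj => ?_
          have : j ≠ a := fun h => ha (h ▸ hj)
          simp [this]
      · rw [h3]
        simp
    · intro i hi
      simp only [Finset.mem_insert, not_or] at hi
      simp [hi.1, h4 i hi.2]
    · rw [cl_biprod, Finset.sum_insert ha, h5]

/-- matrices invertible -/
lemma sum_eq_of_matrix (F : ℤ → A) (S T : Finset ℤ) (m : ∀ i j, F i ⟶ F j)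
    (hST : ∀ i ∈ S, ∀ k ∈ S, i ≠ k → ∑ j ∈ T, m i j ≫ m j k = 0)
    (hST' : ∀ i ∈ S, ∑ j ∈ T, m i j ≫ m j i = 𝟙 _)
    (hTS : ∀ i ∈ T, ∀ k ∈ T, i ≠ k → ∑ j ∈ S, m i j ≫ m j k = 0)
    (hTS' : ∀ i ∈ T, ∑ j ∈ S, m i j ≫ m j i = 𝟙 _) :
    ∑ j ∈ S, cl (F j) = ∑ j ∈ T, cl (F j) := by
  obtain ⟨B, ι, π, h1, h2, h3, -, h5⟩ := exists_sum F S
  obtain ⟨B', ι', π', h1', h2', h3', -, h5'⟩ := exists_sum F T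
  rw [← h5, ← h5']
  have key : ∀ (S T : Finset ℤ) (B B' : A) (ι : ∀ j, F j ⟶ B) (π : ∀ j, B ⟶ F j)
      (ι' : ∀ j, F j ⟶ B') (π' : ∀ j, B' ⟶ F j)
      (_ : ∀ i ∈ S, ∀ k ∈ S, i ≠ k → ∑ j ∈ T, m i j ≫ m j k = 0)
      (_ : ∀ i ∈ S, ∑ j ∈ T, m i j ≫ m j i = 𝟙 _)
      (_ : ∑ j ∈ S, π j ≫ ι j = 𝟙 B)
      (_ : ∀ i ∈ T, ι' i ≫ π' i = 𝟙 _) (_ : ∀ i j, i ≠ j → ι' i ≫ π' j = 0),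
      (∑ i ∈ S, ∑ j ∈ T, π i ≫ m i j ≫ ι' j) ≫ (∑ j ∈ T, ∑ k ∈ S, π' j ≫ m j k ≫ ι k) = 𝟙 B := by
    intro S T B B' ι π ι' π' a1 a2 a3 a4 a5
    have e1 : ∀ i ∈ S, (∑ j ∈ T, π i ≫ m i j ≫ ι' j) ≫ (∑ j ∈ T, ∑ k ∈ S, π' j ≫ m j k ≫ ι k)
        = π i ≫ ι i := by
      intro i hi
      have e2 : ∀ j ∈ T, (π i ≫ m i j ≫ ι' j) ≫ (∑ j ∈ T, ∑ k ∈ S, π' j ≫ m j k ≫ ι k) =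
          ∑ k ∈ S, π i ≫ (m i j ≫ m j k) ≫ ι k := by
        intro j hj
        rw [Preadditive.comp_sum, Finset.sum_eq_single j]
        · rw [Preadditive.comp_sum]
          refine Finset.sum_congr rfl fun k _ => ?_
          simp only [Category.assoc]
          rw [← Category.assoc (ι' j), a4 j hj, Category.id_comp]
        · intro l _ hl
          rw [Preadditive.comp_sum]
          refine Finset.sum_eq_zero fun k _ => ?_
          simp only [Category.assoc]
          rw [← Category.assoc (ι' j), a5 j l hl.symm]
          simp
        · intro h; exact absurd hj h
      rw [Preadditive.sum_comp, Finset.sum_congr rfl e2, Finset.sum_comm]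
      have e3 : ∀ k ∈ S, ∑ j ∈ T, π i ≫ (m i j ≫ m j k) ≫ ι k =
          π i ≫ (∑ j ∈ T, (m i j ≫ m j k)) ≫ ι k := by
        intro k _
        rw [Preadditive.sum_comp, Preadditive.comp_sum]
      rw [Finset.sum_congr rfl e3, Finset.sum_eq_single i]
      · rw [a2 i hi, Category.id_comp]
      · intro k hk hki
        rw [a1 i hi k hk hki.symm]; simp
      · intro h; exact absurd hi h
    rw [Preadditive.sum_comp, Finset.sum_congr rfl e1, a3]
  exact cl_iso ⟨_, _, key S T B B' ι π ι' π' hST hST' h3 h1' h2',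
    key T S B' B ι' π' ι π hTS hTS' h3' h1 h2⟩

section contr

variable (C : CochainComplex A ℤ) (h : Homotopy (𝟙 C) 0)

lemma homotopy_rel (i j k : ℤ) (hj : i + 1 = j) (hk : k + 1 = i) :
    C.d i j ≫ h.hom j i + h.hom i k ≫ C.d k i = 𝟙 _ := by
  have := h.comm i
  rw [dNext_eq _ (show (ComplexShape.up ℤ).Rel i j from hj),
    prevD_eq _ (show (ComplexShape.up ℤ).Rel k i from hk)] at this
  simpa using this.symm

lemma dhd (i j : ℤ) : C.d i j ≫ h.hom j i ≫ C.d i j = C.d i j := by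
  by_cases hij : i + 1 = j
  · have := homotopy_rel C h j (j + 1) i rfl hij
    rw [← eq_sub_iff_add_eq'] at this
    rw [this]
    simp
  · rw [C.shape i j hij]; simp

/-- modified homotopy -/
def hh (i j : ℤ) : C.X i ⟶ C.X j := h.hom i j ≫ C.d j i ≫ h.hom i j

lemma hh_zero (i j : ℤ) (hij : j + 1 ≠ i) : hh C h i j = 0 := by
  simp [hh, C.shape j i hij]

lemma hh_hh (i j k : ℤ) : hh C h i j ≫ hh C h j k = 0 := by
  by_cases hij : j + 1 = i
  · by_cases hjk : k + 1 = j
    · have := homotopy_rel C h j i k hij hjk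
      rw [← eq_sub_iff_add_eq'] at this
      have e : C.d j i ≫ h.hom i j ≫ h.hom j k ≫ C.d k j = 0 := by
        rw [this, Preadditive.comp_sub, Preadditive.comp_sub]
        have := dhd C h j i
        rw [← Category.assoc] at this
        simp only [Category.comp_id]
        rw [sub_eq_zero]
        simp only [← Category.assoc]
        rw [Category.assoc (C.d j i), dhd]
      have e' := h.hom i j ≫= (e =≫ h.hom j k)
      simpa [hh] using e'
    · rw [hh_zero C h j k hjk]; simp
  · rw [hh_zero C h i j hij]; simp

lemma d_hh (i j : ℤ) : C.d i j ≫ hh C h j i = C.d i j ≫ h.hom j i := by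
  have := dhd C h i j =≫ h.hom j i
  simpa [hh] using this

lemma hh_d (i j : ℤ) : hh C h j i ≫ C.d i j = h.hom j i ≫ C.d i j := by
  simp [hh, dhd]

/-- contraction matrix -/
def mm (i j : ℤ) : C.X i ⟶ C.X j := C.d i j + hh C h i j

lemma mm_mm (i j k : ℤ) : mm C h i j ≫ mm C h j k = C.d i j ≫ hh C h j k + hh C h i j ≫ C.d j k := by
  simp [mm, hh_hh, add_comm]

lemma mm_ne (T : Finset ℤ) (i k : ℤ) (hik : i ≠ k) : ∑ j ∈ T, mm C h i j ≫ mm C h j k = 0 := by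
  refine Finset.sum_eq_zero fun j _ => ?_
  rw [mm_mm]
  have e1 : C.d i j ≫ hh C h j k = 0 := by
    by_cases hij : i + 1 = j
    · rw [hh_zero C h j k (by lia)]; simp
    · rw [C.shape i j hij]; simp
  have e2 : hh C h i j ≫ C.d j k = 0 := by
    by_cases hij : j + 1 = i
    · rw [C.shape j k (by simp; lia)]; simp
    · rw [hh_zero C h i j hij]; simp
  rw [e1, e2, add_zero]

lemma mm_eq (T : Finset ℤ) (i : ℤ) (h1 : i + 1 ∉ T → IsZero (C.X (i + 1)))
    (h2 : i - 1 ∉ T → IsZero (C.X (i - 1))) : ∑ j ∈ T, mm C h i j ≫ mm C h j i = 𝟙 _ := by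
  simp_rw [mm_mm]
  rw [Finset.sum_add_distrib, Finset.sum_eq_single (i + 1), Finset.sum_eq_single (i - 1),
    d_hh, hh_d]
  · exact homotopy_rel C h i (i + 1) (i - 1) rfl (by simp)
  · intro j _ hj
    rw [hh_zero C h i j (by lia)]; simp
  · intro hn
    rw [(h2 hn).eq_of_tgt (hh C h i (i - 1)) 0]; simp
  · intro j _ hj
    rw [C.shape i j (by simp; lia)]; simp
  · intro hn
    rw [(h1 hn).eq_of_tgt (C.d i (i + 1)) 0]; simp

end contr

/-- bounded complexes -/
def BC (K : CochainComplex A ℤ) : Prop := ∃ a b : ℤ, ∀ i : ℤ, (i < a ∨ b < i) → IsZero (K.X i)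

/-- Euler characteristic -/
noncomputable def chi (K : CochainComplex A ℤ) : K0sp A := ∑ᶠ i : ℤ, i.negOnePow • cl (K.X i)

lemma chi_eq_sum (K : CochainComplex A ℤ) (a b : ℤ) (hK : ∀ i : ℤ, (i < a ∨ b < i) → IsZero (K.X i)) :
    chi K = ∑ i ∈ Finset.Icc a b, i.negOnePow • cl (K.X i) := by
  refine finsum_eq_sum_of_support_subset _ ?_
  intro i hi
  by_contra hn
  refine hi ?_
  simp only [Finset.coe_Icc, Set.mem_Icc, not_and_or, not_le] at hn
  simp [cl_zero (hK i hn)]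

lemma BC.finite {K : CochainComplex A ℤ} (hK : BC K) :
    (Function.support fun i : ℤ => i.negOnePow • cl (K.X i)).Finite := by
  obtain ⟨a, b, hK⟩ := hK
  refine (Finset.Icc a b).finite_toSet.subset ?_
  intro i hi
  by_contra hn
  refine hi ?_
  simp only [Finset.coe_Icc, Set.mem_Icc, not_and_or, not_le] at hn
  simp [cl_zero (hK i hn)]

lemma chi_contractible (C : CochainComplex A ℤ) (hC : BC C) (h : Homotopy (𝟙 C) 0) : chi C = 0 := by
  obtain ⟨a, b, hab⟩ := hC
  rw [chi_eq_sum C a b hab]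
  rw [← Finset.sum_filter_add_sum_filter_not _ (fun i : ℤ => Even i)]
  have e1 : ∑ i ∈ (Finset.Icc a b).filter (fun i : ℤ => Even i), i.negOnePow • cl (C.X i) =
     ∑ i ∈ (Finset.Icc a b).filter (fun i : ℤ => Even i), cl (C.X i) := by
    refine Finset.sum_congr rfl fun i hi => ?_
    rw [Int.negOnePow_even i (by simpa using (Finset.mem_filter.1 hi).2), one_smul]
  have e2 : ∑ i ∈ (Finset.Icc a b).filter (fun i : ℤ => ¬ Even i), i.negOnePow • cl (C.X i) =
     - ∑ i ∈ (Finset.Icc a b).filter (fun i : ℤ => ¬ Even i), cl (C.X i) := by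
    rw [← Finset.sum_neg_distrib]
    refine Finset.sum_congr rfl fun i hi => ?_
    rw [Int.negOnePow_odd i (by simpa using (Finset.mem_filter.1 hi).2), Units.neg_smul, one_smul]
  rw [e1, e2, ← sub_eq_add_neg, sub_eq_zero]
  refine sum_eq_of_matrix (fun i => C.X i) _ _ (mm C h) ?_ ?_ ?_ ?_
  · intro i _ k _ hik
    exact mm_ne C h _ i k hik
  · intro i hi
    have hi2 := (Finset.mem_filter.1 hi).2
    refine mm_eq C h _ i (fun hn => hab _ ?_) (fun hn => hab _ ?_)
    · by_contra hc
      exact hn (Finset.mem_filter.2 ⟨Finset.mem_Icc.2 (by lia), by rw [Int.even_add_one]; simpa using hi2⟩)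
    · by_contra hc
      exact hn (Finset.mem_filter.2 ⟨Finset.mem_Icc.2 (by lia), by rw [Int.even_sub_one]; simpa using hi2⟩)
  · intro i _ k _ hik
    exact mm_ne C h _ i k hik
  · intro i hi
    have hi2 := (Finset.mem_filter.1 hi).2
    refine mm_eq C h _ i (fun hn => hab _ ?_) (fun hn => hab _ ?_)
    · by_contra hc
      exact hn (Finset.mem_filter.2 ⟨Finset.mem_Icc.2 (by lia), by rw [Int.even_add_one]; simpa using hi2⟩)
    · by_contra hc
      exact hn (Finset.mem_filter.2 ⟨Finset.mem_Icc.2 (by lia), by rw [Int.even_sub_one]; simpa using hi2⟩)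

open CochainComplex in
lemma BC.cone {K L : CochainComplex A ℤ} (f : K ⟶ L) (hK : BC K) (hL : BC L) : BC (mappingCone f) := by
  obtain ⟨a, b, hK⟩ := hK
  obtain ⟨a', b', hL⟩ := hL
  refine ⟨min (a - 1) a', max b b', fun i hi => ?_⟩
  refine IsZero.of_iso ?_ (HomologicalComplex.homotopyCofiber.XIsoBiprod f i (i + 1) rfl)
  exact (biprod_isZero_iff _ _).2 ⟨hK _ (by lia), hL _ (by lia)⟩

open CochainComplex in
lemma chi_cone {K L : CochainComplex A ℤ} (f : K ⟶ L) (hK : BC K) (hL : BC L) :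
    chi (mappingCone f) = chi L - chi K := by
  have e : ∀ i : ℤ, i.negOnePow • cl ((mappingCone f).X i) =
      i.negOnePow • cl (L.X i) - (i + 1).negOnePow • cl (K.X (i + 1)) := by
    intro i
    have : cl ((mappingCone f).X i) = cl (K.X (i + 1)) + cl (L.X i) := by
      rw [← cl_biprod]
      exact cl_iso (HomologicalComplex.homotopyCofiber.XIsoBiprod f i (i + 1) rfl)
    rw [this, Int.negOnePow_succ, Units.neg_smul, smul_add]
    abel
  have e2 : chi K = ∑ᶠ i : ℤ, (i + 1).negOnePow • cl (K.X (i + 1)) :=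
    (finsum_comp_equiv (Equiv.addRight (1 : ℤ)) (f := fun i : ℤ => i.negOnePow • cl (K.X i))).symm
  rw [e2]
  unfold chi
  rw [finsum_congr e, finsum_sub_distrib hL.finite]
  exact hK.finite.preimage (f := fun i : ℤ => i + 1) (add_left_injective 1).injOn

open CochainComplex HomotopyCategory in
lemma chi_iso {X Y : HomotopyCategory A (ComplexShape.up ℤ)} (hX : Bdd A X) (hY : Bdd A Y)
    (e : X ≅ Y) : chi X.as = chi Y.as := by
  obtain ⟨f, hf⟩ := (quotient A (ComplexShape.up ℤ)).map_surjective
    (show (quotient A (ComplexShape.up ℤ)).obj X.as ⟶ (quotient A (ComplexShape.up ℤ)).obj Y.as from e.hom)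
  have hd := mappingCone_triangleh_distinguished f
  have hi : IsIso (mappingCone.triangleh f).mor₁ := by
    change IsIso ((quotient A (ComplexShape.up ℤ)).map f)
    rw [hf]
    change IsIso e.hom
    infer_instance
  have hz := (Triangle.isZero₃_iff_isIso₁ _ hd).2 hi
  obtain ⟨h⟩ := (isZero_quotient_obj_iff (mappingCone f)).1 hz
  have := chi_contractible _ (BC.cone f hX hY) h
  rw [chi_cone f hX hY, sub_eq_zero] at this
  exact this.symm

open CochainComplex HomotopyCategory in
lemma chi_dist (T : Triangle (HomotopyCategory A (ComplexShape.up ℤ))) (hT : T ∈ distTriang _)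
    (h₁ : Bdd A T.obj₁) (h₂ : Bdd A T.obj₂) (h₃ : Bdd A T.obj₃) :
    chi T.obj₁.as - chi T.obj₂.as + chi T.obj₃.as = 0 := by
  obtain ⟨f, hf⟩ := (quotient A (ComplexShape.up ℤ)).map_surjective
    (show (quotient A (ComplexShape.up ℤ)).obj T.obj₁.as ⟶
      (quotient A (ComplexShape.up ℤ)).obj T.obj₂.as from T.mor₁)
  have hd := mappingCone_triangleh_distinguished f
  obtain ⟨e, -⟩ := exists_iso_of_arrow_iso T _ hT hd
    (Arrow.isoMk (Iso.refl T.obj₁) (Iso.refl T.obj₂) (by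
      change 𝟙 _ ≫ (quotient A (ComplexShape.up ℤ)).map f = T.mor₁ ≫ 𝟙 _
      rw [hf, Category.comp_id]
      exact Category.id_comp _))
  have e3 : T.obj₃ ≅ (quotient A (ComplexShape.up ℤ)).obj (mappingCone f) := Triangle.π₃.mapIso e
  have := chi_iso h₃ (BC.cone f h₁ h₂) e3
  change _ = chi (mappingCone f) at this
  rw [this, chi_cone f h₁ h₂]
  abel

/-- class of a bounded complex -/
noncomputable def kcl (X : HomotopyCategory A (ComplexShape.up ℤ)) (h : Bdd A X) : K0Kb A :=
  (QuotientAddGroup.mk (FreeAbelianGroup.of ⟨X, h⟩) :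
    FreeAbelianGroup {X : HomotopyCategory A (ComplexShape.up ℤ) // Bdd A X} ⧸
      AddSubgroup.closure (kbRels A))

lemma kcl_iso {X Y : HomotopyCategory A (ComplexShape.up ℤ)} (hX : Bdd A X) (hY : Bdd A Y)
    (e : X ≅ Y) : kcl X hX = kcl Y hY := by
  refine (QuotientAddGroup.eq_iff_sub_mem).2 (AddSubgroup.subset_closure ?_)
  exact Or.inl ⟨⟨X, hX⟩, ⟨Y, hY⟩, ⟨e⟩, rfl⟩

lemma kcl_dist (T : Triangle (HomotopyCategory A (ComplexShape.up ℤ))) (hT : T ∈ distTriang _)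
    (h₁ : Bdd A T.obj₁) (h₂ : Bdd A T.obj₂) (h₃ : Bdd A T.obj₃) :
    kcl _ h₂ = kcl _ h₁ + kcl _ h₃ := by
  have : (FreeAbelianGroup.of ⟨T.obj₁, h₁⟩ - FreeAbelianGroup.of ⟨T.obj₂, h₂⟩
              + FreeAbelianGroup.of ⟨T.obj₃, h₃⟩ :
      FreeAbelianGroup {X : HomotopyCategory A (ComplexShape.up ℤ) // Bdd A X}) ∈
        AddSubgroup.closure (kbRels A) :=
    AddSubgroup.subset_closure (Or.inr ⟨T, hT, h₁, h₂, h₃, rfl⟩)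
  have h : kcl _ h₁ - kcl _ h₂ + kcl _ h₃ = 0 := (QuotientAddGroup.eq_zero_iff _).2 this
  rw [← sub_eq_zero, ← neg_eq_zero, ← h]
  abel

lemma kcl_shift {X Y Z : HomotopyCategory A (ComplexShape.up ℤ)} (hX : Bdd A X) (hY : Bdd A Y)
    (hZ : Bdd A Z) (e : X⟦(1 : ℤ)⟧ ≅ Y) (hz : IsZero Z) : kcl Z hZ = kcl X hX + kcl Y hY := by
  have hd : Triangle.mk (0 : X ⟶ Z) (0 : Z ⟶ Y) (-e.inv) ∈ distTriang _ := by
    refine isomorphic_distinguished _ (rot_of_distTriang _ (contractible_distinguished X)) _ ?_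
    have h : (-e.inv) ≫ (shiftFunctor _ (1 : ℤ)).map (𝟙 X) =
        e.inv ≫ (-(shiftFunctor _ (1 : ℤ)).map (𝟙 X)) := by
      rw [CategoryTheory.Functor.map_id, Category.comp_id, Preadditive.comp_neg, Category.comp_id]
    exact Triangle.isoMk _ _ (Iso.refl _) (hz.iso (isZero_zero _)) e.symm
      ((isZero_zero _).eq_of_tgt _ _) (hz.eq_of_src _ _) h
  exact kcl_dist _ hd hX hZ hY

lemma bdd_single (n : ℤ) (X : A) :
    Bdd A ((HomotopyCategory.quotient A (ComplexShape.up ℤ)).obj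
      ((HomologicalComplex.single A (ComplexShape.up ℤ) n).obj X)) :=
  ⟨n, n, fun i hi => HomologicalComplex.isZero_single_obj_X _ _ _ _ (by lia)⟩

lemma isZero_complex (K : CochainComplex A ℤ) (hK : ∀ i, IsZero (K.X i)) :
    IsZero ((HomotopyCategory.quotient A (ComplexShape.up ℤ)).obj K) := by
  refine Functor.map_isZero _ ?_
  rw [IsZero.iff_id_eq_zero]
  ext i
  exact (hK i).eq_of_src _ _

lemma kcl_zero {Z : HomotopyCategory A (ComplexShape.up ℤ)} (hZ : Bdd A Z) (hz : IsZero Z) :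
    kcl Z hZ = 0 := by
  have := kcl_shift hZ hZ hZ (IsZero.iso (Functor.map_isZero _ hz) hz) hz
  simpa using this

lemma kcl_single_succ (n : ℤ) (X : A) :
    kcl _ (bdd_single (n + 1) X) = - kcl _ (bdd_single n X) := by
  have hz : IsZero ((HomotopyCategory.quotient A (ComplexShape.up ℤ)).obj
      ((HomologicalComplex.single A (ComplexShape.up ℤ) 0).obj (0 : A))) :=
    Functor.map_isZero _ (Functor.map_isZero _ (isZero_zero A))
  have hb := bdd_single 0 (0 : A)
  have := kcl_shift (bdd_single (n + 1) X) (bdd_single n X) hb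
    (((HomotopyCategory.singleFunctors A).shiftIso 1 n (n + 1) (by ring)).app X) hz
  rw [kcl_zero hb hz] at this
  exact eq_neg_of_add_eq_zero_left this.symm

/-- the single functor -/
noncomputable abbrev sF : A ⥤ HomotopyCategory A (ComplexShape.up ℤ) :=
  HomologicalComplex.single A (ComplexShape.up ℤ) 0 ⋙ HomotopyCategory.quotient A (ComplexShape.up ℤ)

instance : (sF (A := A)).Additive := by unfold sF; infer_instance

noncomputable instance (X Y : A) : PreservesBinaryBiproduct X Y (sF (A := A)) :=
  have := Functor.preservesFiniteBiproductsOfAdditive (sF (A := A))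
  have := preservesBinaryBiproducts_of_preservesBiproducts (sF (A := A))
  inferInstance

lemma kcl_single_biprod (X Y : A) :
    kcl _ (bdd_single 0 (X ⊞ Y)) = kcl _ (bdd_single 0 X) + kcl _ (bdd_single 0 Y) := by
  have hd : Triangle.mk (sF.map (biprod.inl : X ⟶ X ⊞ Y)) (sF.map (biprod.snd : X ⊞ Y ⟶ Y)) 0
      ∈ distTriang _ := by
    refine isomorphic_distinguished _ (binaryBiproductTriangle_distinguished (sF.obj X) (sF.obj Y)) _ ?_
    have h1 : sF.map (biprod.inl : X ⟶ X ⊞ Y) ≫ (sF.mapBiprod X Y).hom = 𝟙 _ ≫ biprod.inl := by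
      apply biprod.hom_ext
      · rw [Category.assoc, Functor.mapBiprod_hom, biprod.lift_fst, ← Functor.map_comp]
        simp
      · rw [Category.assoc, Functor.mapBiprod_hom, biprod.lift_snd, ← Functor.map_comp]
        simp
    have h2 : sF.map (biprod.snd : X ⊞ Y ⟶ Y) ≫ 𝟙 _ = (sF.mapBiprod X Y).hom ≫ biprod.snd := by
      rw [Functor.mapBiprod_hom, biprod.lift_snd, Category.comp_id]
    exact Triangle.isoMk _ _ (Iso.refl _) (sF.mapBiprod X Y) (Iso.refl _) h1 h2
      (zero_comp.trans comp_zero.symm)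
  exact kcl_dist _ hd (bdd_single 0 X) (bdd_single 0 (X ⊞ Y)) (bdd_single 0 Y)

variable (A) in
/-- the canonical map -/
noncomputable def phi : K0sp A →+ K0Kb A :=
  QuotientAddGroup.lift (AddSubgroup.closure (splitRels A))
    (FreeAbelianGroup.lift fun X => kcl _ (bdd_single 0 X)) (by
      rw [AddSubgroup.closure_le]
      rintro z (⟨X, Y, ⟨e⟩, rfl⟩ | ⟨X, Y, rfl⟩)
      · simp [kcl_iso (bdd_single 0 X) (bdd_single 0 Y) (sF.mapIso e)]
      · simp [kcl_single_biprod])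

lemma phi_cl (X : A) : phi A (cl X) = kcl _ (bdd_single 0 X) := by
  exact FreeAbelianGroup.lift_apply_of _ _

variable (A) in
/-- the inverse map -/
noncomputable def psi : K0Kb A →+ K0sp A :=
  QuotientAddGroup.lift (AddSubgroup.closure (kbRels A))
    (FreeAbelianGroup.lift fun X => chi X.1.as) (by
      rw [AddSubgroup.closure_le]
      rintro z (⟨X, Y, ⟨e⟩, rfl⟩ | ⟨T, hT, h₁, h₂, h₃, rfl⟩)
      · simp [chi_iso X.2 Y.2 e]
      · simpa using chi_dist T hT h₁ h₂ h₃)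

lemma psi_kcl (X : HomotopyCategory A (ComplexShape.up ℤ)) (h : Bdd A X) :
    psi A (kcl X h) = chi X.as := by
  exact FreeAbelianGroup.lift_apply_of _ _

lemma chi_single (X : A) : chi ((HomologicalComplex.single A (ComplexShape.up ℤ) 0).obj X) = cl X := by
  unfold chi
  rw [finsum_eq_single _ 0]
  · rw [Int.negOnePow_zero, one_smul]
    exact cl_iso (HomologicalComplex.singleObjXSelf _ 0 X)
  · intro n hn
    rw [cl_zero (HomologicalComplex.isZero_single_obj_X _ _ _ _ hn), smul_zero]

lemma psi_phi (x : K0sp A) : psi A (phi A x) = x := by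
  have : ((psi A).comp (phi A)).comp (QuotientAddGroup.mk' (AddSubgroup.closure (splitRels A))) =
      QuotientAddGroup.mk' (AddSubgroup.closure (splitRels A)) := by
    ext X
    change psi A (phi A (cl X)) = cl X
    rw [phi_cl, psi_kcl]
    exact chi_single X
  obtain ⟨y, rfl⟩ := QuotientAddGroup.mk'_surjective _ x
  exact DFunLike.congr_fun this y

lemma single_mem (n : ℤ) (X : A) : kcl _ (bdd_single n X) ∈ (phi A).range := by
  induction n using Int.induction_on with
  | zero => exact ⟨cl X, phi_cl X⟩
  | succ i ih => rw [kcl_single_succ]; exact neg_mem ih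
  | pred i ih =>
    have := kcl_single_succ (-(i : ℤ) - 1) X
    have e : kcl _ (bdd_single (-(i : ℤ) - 1 + 1) X) = kcl _ (bdd_single (-(i : ℤ)) X) := by
      congr 3; ring_nf
    rw [e] at this
    rw [← neg_neg (kcl _ (bdd_single (-(i : ℤ) - 1) X)), ← this]
    exact neg_mem ih

lemma exists_trunc (K : CochainComplex A ℤ) (b : ℤ) (hK : ∀ i, b < i → IsZero (K.X i)) :
    ∃ (Y : CochainComplex A ℤ),
      (∀ i, b ≤ i → IsZero (Y.X i)) ∧ (∀ i, IsZero (K.X i) → IsZero (Y.X i)) ∧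
      ∃ T ∈ distTriang (HomotopyCategory A (ComplexShape.up ℤ)),
        T.obj₁ = (HomotopyCategory.quotient A (ComplexShape.up ℤ)).obj
          ((HomologicalComplex.single A (ComplexShape.up ℤ) b).obj (K.X b)) ∧
        T.obj₂ = (HomotopyCategory.quotient A (ComplexShape.up ℤ)).obj K ∧
        T.obj₃ = (HomotopyCategory.quotient A (ComplexShape.up ℤ)).obj Y := by
  have hc : ∀ i, ∃ (Y : A) (p : K.X i ⟶ Y) (s : Y ⟶ K.X i), s ≫ p = 𝟙 _ ∧
      (i < b → p ≫ s = 𝟙 _) ∧ (b ≤ i → IsZero Y) := by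
    intro i
    by_cases hi : i < b
    · exact ⟨K.X i, 𝟙 _, 𝟙 _, by simp, by simp, fun h => absurd hi (by lia)⟩
    · exact ⟨(0 : A), 0, 0, (isZero_zero A).eq_of_src _ _, fun h => absurd h hi,
        fun _ => isZero_zero A⟩
  choose Y p s h1 h2 h3 using hc
  let L : CochainComplex A ℤ :=
    { X := Y
      d := fun i j => s i ≫ K.d i j ≫ p j
      shape := fun i j hij => by rw [K.shape i j hij]; simp
      d_comp_d' := by
        intro i j k hij hjk
        by_cases hj : j < b
        · have := h2 j hj
          simp only [Category.assoc]
          rw [← Category.assoc (p j), this]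
          simp
        · simp only [ComplexShape.up_Rel] at hij hjk
          exact (h3 k (by lia)).eq_of_tgt _ _ }
  let g : K ⟶ L :=
    { f := p
      comm' := by
        intro i j hij
        by_cases hi : i < b
        · change p i ≫ s i ≫ K.d i j ≫ p j = _
          rw [← Category.assoc, h2 i hi, Category.id_comp]
        · simp only [ComplexShape.up_Rel] at hij
          exact (h3 j (by lia)).eq_of_tgt _ _ }
  let f : (HomologicalComplex.single A (ComplexShape.up ℤ) b).obj (K.X b) ⟶ K :=
    HomologicalComplex.mkHomFromSingle (𝟙 _) (by
      intro k hk
      simp only [ComplexShape.up_Rel] at hk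
      exact (hK k (by lia)).eq_of_tgt _ _)
  let S : ShortComplex (CochainComplex A ℤ) := ShortComplex.mk f g (by
    apply HomologicalComplex.from_single_hom_ext
    exact (h3 b le_rfl).eq_of_tgt _ _)
  have hσ : ∀ n, Nonempty ((S.map (HomologicalComplex.eval A _ n)).Splitting) := by
    intro n
    by_cases hn : n = b
    · subst hn
      have hf : f.f n = (HomologicalComplex.singleObjXSelf (ComplexShape.up ℤ) n (K.X n)).hom := by
        simp [f]
      have q1 : f.f n ≫ (HomologicalComplex.singleObjXSelf (ComplexShape.up ℤ) n (K.X n)).inv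
          = 𝟙 _ := by rw [hf]; simp
      have q2 : (HomologicalComplex.singleObjXSelf (ComplexShape.up ℤ) n (K.X n)).inv ≫ f.f n
          + p n ≫ 0 = 𝟙 (K.X n) := by rw [hf]; simp
      exact ⟨{ r := (HomologicalComplex.singleObjXSelf (ComplexShape.up ℤ) n (K.X n)).inv
               s := 0
               f_r := q1
               s_g := (h3 n le_rfl).eq_of_tgt _ _
               id := q2 }⟩
    · have hz : IsZero (((HomologicalComplex.single A (ComplexShape.up ℤ) b).obj (K.X b)).X n) :=
        HomologicalComplex.isZero_single_obj_X _ _ _ _ hn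
      have q2 : (0 : K.X n ⟶ _) ≫ f.f n + p n ≫ s n = 𝟙 (K.X n) := by
        by_cases hb : n < b
        · rw [h2 n hb]; simp
        · exact (hK n (by lia)).eq_of_src _ _
      exact ⟨{ r := 0
               s := s n
               f_r := hz.eq_of_src _ _
               s_g := h1 n
               id := q2 }⟩
  refine ⟨L, h3, fun i hi => ?_, CochainComplex.trianglehOfDegreewiseSplit S (fun n => (hσ n).some),
    (HomotopyCategory.distinguished_iff_iso_trianglehOfDegreewiseSplit _).2 ⟨S, _, ⟨Iso.refl _⟩⟩,
    rfl, rfl, rfl⟩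
  rw [IsZero.iff_id_eq_zero]
  change 𝟙 (Y i) = 0
  rw [← h1 i, hi.eq_of_src (p i) 0, comp_zero]

lemma kcl_mem (n : ℕ) : ∀ (a : ℤ) (K : CochainComplex A ℤ)
    (_ : ∀ i : ℤ, (i < a ∨ a + n ≤ i) → IsZero (K.X i))
    (h : Bdd A ((HomotopyCategory.quotient A (ComplexShape.up ℤ)).obj K)),
    kcl _ h ∈ (phi A).range := by
  induction n with
  | zero =>
    intro a K hK h
    rw [kcl_zero h (isZero_complex K fun i => hK i (by lia))]
    exact zero_mem _
  | succ n ih =>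
    intro a K hK h
    obtain ⟨Y, hY1, hY2, T, hT, e1, e2, e3⟩ := exists_trunc K (a + n) (fun i hi => hK i (by lia))
    have hY : ∀ i : ℤ, (i < a ∨ a + n ≤ i) → IsZero (Y.X i) := by
      rintro i (hi | hi)
      · exact hY2 i (hK i (Or.inl hi))
      · exact hY1 i hi
    have hYb : Bdd A ((HomotopyCategory.quotient A (ComplexShape.up ℤ)).obj Y) :=
      ⟨a, a + n, fun i hi => hY i (by lia)⟩
    obtain ⟨X1, X2, X3, f1, f2, f3⟩ := T
    dsimp at e1 e2 e3
    subst e1 e2 e3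
    have := kcl_dist _ hT (bdd_single _ _) h hYb
    dsimp at this
    rw [this]
    exact add_mem (single_mem _ _) (ih a Y hY hYb)

lemma phi_surjective : Function.Surjective (phi A) := by
  intro x
  obtain ⟨y, rfl⟩ := QuotientAddGroup.mk'_surjective _ x
  change _ ∈ (phi A).range
  induction y using FreeAbelianGroup.induction_on with
  | zero => exact zero_mem _
  | of X =>
    obtain ⟨X, hX⟩ := X
    obtain ⟨a, b, hab⟩ := id hX
    exact kcl_mem (b + 1 - a).toNat a X.as (fun i hi => hab i (by lia)) hX
  | neg X hX => exact neg_mem hX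
  | add x y hx hy => exact add_mem hx hy

end KbAux

/-- For a (skeletally small) additive category `A`, the canonical map from the split
Grothendieck group `K₀^sp(A)` to the Grothendieck group `K₀(K^b(A))` of the bounded
homotopy category, sending the class of `X` to the class of the complex `X`
concentrated in degree `0`, is an isomorphism of abelian groups. -/
theorem statement6 :
    ∃ φ : K0sp A →+ K0Kb A,
      (∀ (X : A) (hX : Bdd A (singleK A X)),
        φ (QuotientAddGroup.mk (FreeAbelianGroup.of X))
          = QuotientAddGroup.mk (FreeAbelianGroup.of ⟨singleK A X, hX⟩)) ∧
      Function.Bijective φ := by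
  exact ⟨KbAux.phi A, fun X hX => KbAux.phi_cl X,
    Function.LeftInverse.injective KbAux.psi_phi, KbAux.phi_surjective⟩
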